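/- Let Q be a quasivariety. If Q_RFSI has the Q-congruence extension property, then Q_RFSI has the extension property. -/

import Mathlib

open FirstOrder Language Set

universe u

namespace Transfer

variable (L : FirstOrder.Language.{u, u})

/-- A bundled `L`-structure with carrier in universe `u`. -/
structure Struc : Type (u + 1) where
  Carrier : Type u
  [str : L.Structure Carrier]

attribute [instance] Struc.str

/-- Product structure on a Pi type. -/
instance piStructure {ι : Type u} (M : ι → Type u) [∀ i, L.Structure (M i)] :
    L.Structure (∀ i, M i) where
  funMap f x i := Structure.funMap f fun j => x j i
  RelMap r x := ∀ i, Structure.RelMap r fun j => x j i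

/-- Product structure on a binary product. -/
instance prodStructure (M N : Type u) [L.Structure M] [L.Structure N] :
    L.Structure (M × N) where
  funMap f x := (Structure.funMap f fun j => (x j).1, Structure.funMap f fun j => (x j).2)
  RelMap r x := Structure.RelMap r (fun j => (x j).1) ∧ Structure.RelMap r (fun j => (x j).2)

variable {L}

/-- The bundled structure on a substructure. -/
abbrev ofSub (B : Struc L) (S : L.Substructure B.Carrier) : Struc L := ⟨S⟩

/-- The kernel of a map, as a set of pairs. -/
def kerSet {α β : Type u} (f : α → β) : Set (α × α) := {p | f p.1 = f p.2}

/-- The restriction of a binary relation on `B` to a substructure `S`. -/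
def restrict {B : Struc L} (S : L.Substructure B.Carrier)
    (Θ : Set (B.Carrier × B.Carrier)) : Set ((ofSub B S).Carrier × (ofSub B S).Carrier) :=
  {p | ((p.1 : B.Carrier), (p.2 : B.Carrier)) ∈ Θ}

/-- The image of a binary relation on a substructure `S` in `B`. -/
def lift {B : Struc L} (S : L.Substructure B.Carrier)
    (Θ : Set ((ofSub B S).Carrier × (ofSub B S).Carrier)) : Set (B.Carrier × B.Carrier) :=
  (fun p => ((p.1 : B.Carrier), (p.2 : B.Carrier))) '' Θ

/-- The set of `Q`-congruences of `A`: kernels of homomorphisms into members of `Q`. -/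
def ConQ (Q : Set (Struc L)) (A : Struc L) : Set (Set (A.Carrier × A.Carrier)) :=
  {θ | ∃ M ∈ Q, ∃ f : A.Carrier →[L] M.Carrier, θ = kerSet f}

/-- The least `Q`-congruence of `A` containing `R`. -/
def cgQ (Q : Set (Struc L)) (A : Struc L) (R : Set (A.Carrier × A.Carrier)) :
    Set (A.Carrier × A.Carrier) :=
  ⋂₀ {θ | θ ∈ ConQ Q A ∧ R ⊆ θ}

/-- The join of two `Q`-congruences in `Con_Q A`. -/
def joinQ (Q : Set (Struc L)) (A : Struc L) (θ φ : Set (A.Carrier × A.Carrier)) :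
    Set (A.Carrier × A.Carrier) :=
  cgQ Q A (θ ∪ φ)

/-- `θ` is a meet-irreducible element of `Con_Q A`. -/
def MeetIrred (Q : Set (Struc L)) (A : Struc L) (θ : Set (A.Carrier × A.Carrier)) : Prop :=
  θ ∈ ConQ Q A ∧
    ∀ θ₁ ∈ ConQ Q A, ∀ θ₂ ∈ ConQ Q A, θ = θ₁ ∩ θ₂ → θ = θ₁ ∨ θ = θ₂

/-- `θ` is a completely meet-irreducible element of `Con_Q A`. -/
def CompletelyMeetIrred (Q : Set (Struc L)) (A : Struc L)
    (θ : Set (A.Carrier × A.Carrier)) : Prop :=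
  θ ∈ ConQ Q A ∧
    ∀ S ⊆ ConQ Q A, θ = ⋂₀ S → θ ∈ S

/-- The class of relatively finitely subdirectly irreducible members of `Q`. -/
def RFSI (Q : Set (Struc L)) : Set (Struc L) :=
  {A | A ∈ Q ∧ MeetIrred Q A (Set.diagonal A.Carrier)}

/-- The class of relatively subdirectly irreducible members of `Q`. -/
def RSI (Q : Set (Struc L)) : Set (Struc L) :=
  {A | A ∈ Q ∧ CompletelyMeetIrred Q A (Set.diagonal A.Carrier)}

/-- `B` has the `Q`-congruence extension property. -/
def HasQCEP (Q : Set (Struc L)) (B : Struc L) : Prop :=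
  ∀ S : L.Substructure B.Carrier, ∀ θ ∈ ConQ Q (ofSub B S),
    ∃ Φ ∈ ConQ Q B, restrict S Φ = θ

/-- A class `K` of members of `Q` has the `Q`-congruence extension property. -/
def ClassQCEP (Q K : Set (Struc L)) : Prop :=
  ∀ B ∈ K, HasQCEP Q B

variable (L)

/-- `Q` is a quasivariety: closed under isomorphisms, substructures, direct products,
and ultraproducts. -/
def IsQuasivariety (Q : Set (Struc L)) : Prop :=
  (∀ A ∈ Q, ∀ B : Struc L, Nonempty (A.Carrier ≃[L] B.Carrier) → B ∈ Q) ∧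
  (∀ B ∈ Q, ∀ S : L.Substructure B.Carrier, ofSub B S ∈ Q) ∧
  (∀ (ι : Type u) (f : ι → Struc L), (∀ i, f i ∈ Q) →
    (⟨∀ i, (f i).Carrier⟩ : Struc L) ∈ Q) ∧
  (∀ (ι : Type u) (f : ι → Struc L) (U : Ultrafilter ι), (∀ i, f i ∈ Q) →
    (⟨(U : Filter ι).Product fun i => (f i).Carrier⟩ : Struc L) ∈ Q)

/-- `V` is a variety: closed under homomorphic images, substructures, and direct products. -/
def IsVariety (V : Set (Struc L)) : Prop :=
  (∀ A ∈ V, ∀ B : Struc L, ∀ f : A.Carrier →[L] B.Carrier, Function.Surjective f → B ∈ V) ∧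
  (∀ B ∈ V, ∀ S : L.Substructure B.Carrier, ofSub B S ∈ V) ∧
  (∀ (ι : Type u) (f : ι → Struc L), (∀ i, f i ∈ V) →
    (⟨∀ i, (f i).Carrier⟩ : Struc L) ∈ V)

variable {L}

/-- `Q` is relatively congruence-distributive: `Con_Q A` is a distributive lattice
for every `A ∈ Q`. -/
def RelCongDist (Q : Set (Struc L)) : Prop :=
  ∀ A ∈ Q, ∀ θ ∈ ConQ Q A, ∀ φ ∈ ConQ Q A, ∀ ψ ∈ ConQ Q A,
    θ ∩ joinQ Q A φ ψ = joinQ Q A (θ ∩ φ) (θ ∩ ψ)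

/-- Relation composition `Θ ∘ Φ = {(a,c) : ∃ b, (a,b) ∈ Φ ∧ (b,c) ∈ Θ}`. -/
def relComp {α : Type u} (Θ Φ : Set (α × α)) : Set (α × α) :=
  {p | ∃ b, (p.1, b) ∈ Φ ∧ (b, p.2) ∈ Θ}

/-- `Q` is relatively congruence-permutable. -/
def RelCongPerm (Q : Set (Struc L)) : Prop :=
  ∀ A ∈ Q, ∀ θ ∈ ConQ Q A, ∀ φ ∈ ConQ Q A, relComp θ φ = relComp φ θ

/-- A class `K` is closed under substructures. -/
def SubClosed (K : Set (Struc L)) : Prop :=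
  ∀ B ∈ K, ∀ S : L.Substructure B.Carrier, ofSub B S ∈ K

/-- A class `K` is closed under isomorphisms. -/
def IsoClosed (K : Set (Struc L)) : Prop :=
  ∀ A ∈ K, ∀ B : Struc L, Nonempty (A.Carrier ≃[L] B.Carrier) → B ∈ K

/-- A universal class: closed under isomorphisms, substructures, and ultraproducts. -/
def IsUniversalClass (K : Set (Struc L)) : Prop :=
  IsoClosed K ∧ SubClosed K ∧
  (∀ (ι : Type u) (f : ι → Struc L) (U : Ultrafilter ι), (∀ i, f i ∈ K) →
    (⟨(U : Filter ι).Product fun i => (f i).Carrier⟩ : Struc L) ∈ K)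

/-- The extension property for a class `K`. -/
def HasEP (K : Set (Struc L)) : Prop :=
  ∀ A ∈ K, ∀ B ∈ K, ∀ C ∈ K,
    ∀ (φB : A.Carrier →[L] B.Carrier) (φC : A.Carrier →[L] C.Carrier),
      Function.Injective φB → Function.Surjective φC →
      ∃ D ∈ K, ∃ (ψB : B.Carrier →[L] D.Carrier) (ψC : C.Carrier →[L] D.Carrier),
        Function.Injective ψC ∧ ∀ a, ψB (φB a) = ψC (φC a)

/-- The one-sided amalgamation property for a class `K`. -/
def Has1AP (K : Set (Struc L)) : Prop :=
  ∀ A ∈ K, ∀ B ∈ K, ∀ C ∈ K,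
    ∀ (φB : A.Carrier →[L] B.Carrier) (φC : A.Carrier →[L] C.Carrier),
      Function.Injective φB → Function.Injective φC →
      ∃ D ∈ K, ∃ (ψB : B.Carrier →[L] D.Carrier) (ψC : C.Carrier →[L] D.Carrier),
        Function.Injective ψC ∧ ∀ a, ψB (φB a) = ψC (φC a)

/-- Every doubly injective span in `K` has an amalgam in `K'`. -/
def HasAmalgamIn (K K' : Set (Struc L)) : Prop :=
  ∀ A ∈ K, ∀ B ∈ K, ∀ C ∈ K,
    ∀ (φB : A.Carrier →[L] B.Carrier) (φC : A.Carrier →[L] C.Carrier),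
      Function.Injective φB → Function.Injective φC →
      ∃ D ∈ K', ∃ (ψB : B.Carrier →[L] D.Carrier) (ψC : C.Carrier →[L] D.Carrier),
        Function.Injective ψB ∧ Function.Injective ψC ∧ ∀ a, ψB (φB a) = ψC (φC a)

/-- The amalgamation property for a class `K`. -/
def HasAP (K : Set (Struc L)) : Prop := HasAmalgamIn K K

/-- The transferable injections property for a class `K`. -/
def HasTIP (K : Set (Struc L)) : Prop :=
  ∀ A ∈ K, ∀ B ∈ K, ∀ C ∈ K,
    ∀ (φB : A.Carrier →[L] B.Carrier) (φC : A.Carrier →[L] C.Carrier),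
      Function.Injective φB →
      ∃ D ∈ K, ∃ (ψB : B.Carrier →[L] D.Carrier) (ψC : C.Carrier →[L] D.Carrier),
        Function.Injective ψC ∧ ∀ a, ψB (φB a) = ψC (φC a)

/-- Every doubly injective span in `K` has a strong amalgam in `K'`. -/
def HasStrongAmalgamIn (K K' : Set (Struc L)) : Prop :=
  ∀ A ∈ K, ∀ B ∈ K, ∀ C ∈ K,
    ∀ (φB : A.Carrier →[L] B.Carrier) (φC : A.Carrier →[L] C.Carrier),
      Function.Injective φB → Function.Injective φC →
      ∃ D ∈ K', ∃ (ψB : B.Carrier →[L] D.Carrier) (ψC : C.Carrier →[L] D.Carrier),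
        Function.Injective ψB ∧ Function.Injective ψC ∧ (∀ a, ψB (φB a) = ψC (φC a)) ∧
        Set.range (fun a => ψB (φB a)) = Set.range ψB ∩ Set.range ψC

/-- The strong amalgamation property for a class `K`. -/
def HasSAP (K : Set (Struc L)) : Prop := HasStrongAmalgamIn K K

/-- `φ : A → B` is an epimorphism in the class `K`. -/
def IsEpiIn (K : Set (Struc L)) {A B : Struc L} (φ : A.Carrier →[L] B.Carrier) : Prop :=
  ∀ C ∈ K, ∀ ψ₁ ψ₂ : B.Carrier →[L] C.Carrier,
    ψ₁.comp φ = ψ₂.comp φ → ψ₁ = ψ₂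

/-- The class `K` has surjective epimorphisms. -/
def HasSE (K : Set (Struc L)) : Prop :=
  ∀ A ∈ K, ∀ B ∈ K, ∀ φ : A.Carrier →[L] B.Carrier,
    IsEpiIn K φ → Function.Surjective φ

/-- A substructure `S` of `B` is a retract of `B`. -/
def IsRetract (B : Struc L) (S : L.Substructure B.Carrier) : Prop :=
  ∃ ψ : B.Carrier →[L] (ofSub B S).Carrier, ∀ a : (ofSub B S).Carrier, ψ (a : B.Carrier) = a


/-- The smallest variety containing `V₁ ∪ V₂`. -/
def varJoin (L : FirstOrder.Language.{u, u}) (V₁ V₂ : Set (Struc L)) : Set (Struc L) :=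
  ⋂₀ {W | IsVariety L W ∧ V₁ ⊆ W ∧ V₂ ⊆ W}

/-- In an algebraic language, a homomorphism whose kernel contains the kernel of a surjective
homomorphism factors through the latter. -/
theorem exists_hom_factor {L : FirstOrder.Language.{u, u}} [L.IsAlgebraic] {A C M : Type u}
    [L.Structure A] [L.Structure C] [L.Structure M] (g : A →[L] C) (f : A →[L] M)
    (hg : Function.Surjective g) (hgf : kerSet g ⊆ kerSet f) :
    ∃ k : C →[L] M, ∀ a, k (g a) = f a := by
  obtain ⟨s, hs⟩ := hg.hasRightInverse
  have hsf : ∀ a, f (s (g a)) = f a := fun a => @hgf (s (g a), a) (hs (g a))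
  refine ⟨⟨fun c => f (s c), fun {n} F x => ?_, fun r => isEmptyElim r⟩, hsf⟩
  have hx : x = g ∘ (s ∘ x) := funext fun i => (hs (x i)).symm
  change f (s (Structure.funMap F x)) = Structure.funMap F (f ∘ (s ∘ x))
  rw [← f.map_fun, ← hsf (Structure.funMap F (s ∘ x)), g.map_fun, ← hx]

theorem preimage_mem_ConQ {L : FirstOrder.Language.{u, u}} {Q : Set (Struc L)} {A B : Struc L}
    (φ : A.Carrier →[L] B.Carrier) {θ : Set (B.Carrier × B.Carrier)} (hθ : θ ∈ ConQ Q B) :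
    Prod.map φ φ ⁻¹' θ ∈ ConQ Q A := by
  obtain ⟨M, hM, f, rfl⟩ := hθ
  exact ⟨M, hM, f.comp φ, rfl⟩

theorem diagonal_mem_ConQ {L : FirstOrder.Language.{u, u}} {Q : Set (Struc L)} {A : Struc L}
    (hA : A ∈ Q) : Set.diagonal A.Carrier ∈ ConQ Q A :=
  ⟨A, hA, FirstOrder.Language.Hom.id L _, rfl⟩

/-- The `Q`-congruences containing the kernel of a surjection `g` are pulled back along `g`. -/
theorem exists_preimage_eq {L : FirstOrder.Language.{u, u}} [L.IsAlgebraic] {Q : Set (Struc L)}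
    {A C : Struc L} {g : A.Carrier →[L] C.Carrier} (hg : Function.Surjective g)
    {θ : Set (A.Carrier × A.Carrier)} (hθ : θ ∈ ConQ Q A) (hle : kerSet g ⊆ θ) :
    ∃ η ∈ ConQ Q C, Prod.map g g ⁻¹' η = θ := by
  obtain ⟨M, hM, f, rfl⟩ := hθ
  obtain ⟨k, hk⟩ := exists_hom_factor g f hg hle
  exact ⟨kerSet k, ⟨M, hM, k, rfl⟩, by ext ⟨a, b⟩; simp [kerSet, hk]⟩

theorem meetIrred_kerSet_iff {L : FirstOrder.Language.{u, u}} [L.IsAlgebraic] {Q : Set (Struc L)}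
    {A C : Struc L} {g : A.Carrier →[L] C.Carrier} (hg : Function.Surjective g) (hC : C ∈ Q) :
    MeetIrred Q A (kerSet g) ↔ C ∈ RFSI Q := by
  have hinj : Function.Injective (Set.preimage (Prod.map g g)) :=
    (hg.prodMap hg).preimage_injective
  have hker : kerSet g = Prod.map g g ⁻¹' Set.diagonal C.Carrier := rfl
  constructor
  · rintro ⟨-, hirr⟩
    refine ⟨hC, diagonal_mem_ConQ hC, fun θ₁ h₁ θ₂ h₂ heq => ?_⟩
    have := hirr _ (preimage_mem_ConQ g h₁) _ (preimage_mem_ConQ g h₂)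
      (by rw [hker, heq, Set.preimage_inter])
    rw [hker] at this
    exact this.imp (fun h => hinj h) (fun h => hinj h)
  · rintro ⟨-, -, hirr⟩
    refine ⟨⟨C, hC, g, rfl⟩, fun θ₁ h₁ θ₂ h₂ heq => ?_⟩
    obtain ⟨η₁, hη₁, rfl⟩ := exists_preimage_eq hg h₁ (heq.trans_subset inter_subset_left)
    obtain ⟨η₂, hη₂, rfl⟩ := exists_preimage_eq hg h₂ (heq.trans_subset inter_subset_right)
    rw [hker, ← Set.preimage_inter] at heq
    rw [hker]
    exact (hirr _ hη₁ _ hη₂ (hinj heq)).imp (congrArg _) (congrArg _)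

/-- Unions of nonempty chains of `Q`-congruences are `Q`-congruences. -/
theorem sUnion_mem_ConQ {L : FirstOrder.Language.{u, u}} [L.IsAlgebraic] {Q : Set (Struc L)}
    (hQ : IsQuasivariety L Q) {B : Struc L} {c : Set (Set (B.Carrier × B.Carrier))}
    (hc : c ⊆ ConQ Q B) (hchain : IsChain (· ⊆ ·) c) (hne : c.Nonempty) :
    ⋃₀ c ∈ ConQ Q B := by
  choose M hM f hf using fun θ : c => hc θ.2
  have : Nonempty c := hne.to_subtype
  have : IsDirectedOrder c := ⟨hchain.directedOn.directed_val⟩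
  let U : Ultrafilter c := Ultrafilter.of Filter.atTop
  have hU : ∀ θ : c, ∀ᶠ η in (U : Filter c), θ ≤ η := fun θ =>
    Ultrafilter.of_le Filter.atTop (Filter.eventually_ge_atTop θ)
  refine ⟨_, hQ.2.2.2 c M U hM,
    ⟨fun b => Quotient.mk ((U : Filter c).productSetoid _) fun θ => f θ b, fun {n} F x => ?_, fun r => isEmptyElim r⟩, ?_⟩
  · simp only [FirstOrder.Language.Hom.map_fun]
    exact (FirstOrder.Language.Ultraproduct.funMap_cast F fun i θ => f θ (x i)).symm
  · ext ⟨a, b⟩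
    have hmem : ∀ θ : c, (a, b) ∈ θ.1 ↔ f θ a = f θ b := fun θ => by
      conv_lhs => rw [hf θ]
      rfl
    refine Iff.trans ?_ (Quotient.eq (r := (U : Filter c).productSetoid _)).symm
    change _ ↔ ∀ᶠ θ in (U : Filter c), f θ a = f θ b
    simp only [← hmem]
    constructor
    · rintro ⟨θ, hθ, hab⟩
      exact (hU ⟨θ, hθ⟩).mono fun η hη => hη hab
    · intro hab
      obtain ⟨θ, hθ⟩ := hab.exists
      exact ⟨θ, θ.2, hθ⟩

/-- Congruence extension along an arbitrary injective homomorphism. -/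
theorem HasQCEP.exists_preimage_eq {L : FirstOrder.Language.{u, u}} [L.IsAlgebraic]
    {Q : Set (Struc L)} {A B : Struc L} (hB : HasQCEP Q B) {φ : A.Carrier →[L] B.Carrier}
    (hφ : Function.Injective φ) {θ : Set (A.Carrier × A.Carrier)} (hθ : θ ∈ ConQ Q A) :
    ∃ Φ ∈ ConQ Q B, Prod.map φ φ ⁻¹' Φ = θ := by
  let φ' : A.Carrier →[L] (ofSub B φ.range).Carrier :=
    φ.codRestrict φ.range fun a => ⟨a, rfl⟩
  have hker : kerSet φ' ⊆ θ := by
    obtain ⟨M, -, f, rfl⟩ := hθ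
    rintro ⟨a, b⟩ hab
    exact congrArg f (hφ (congrArg Subtype.val hab))
  have hsurj : Function.Surjective φ' := by
    rintro ⟨_, a, rfl⟩
    exact ⟨a, rfl⟩
  obtain ⟨η, hη, rfl⟩ := Transfer.exists_preimage_eq hsurj hθ hker
  obtain ⟨Φ, hΦ, rfl⟩ := hB φ.range η hη
  exact ⟨Φ, hΦ, rfl⟩

/-- Every `Q`-congruence of `B` is the kernel of a surjection onto a member of `Q`. -/
theorem exists_surjective_kerSet_eq {L : FirstOrder.Language.{u, u}} {Q : Set (Struc L)}
    (hQ : IsQuasivariety L Q) {B : Struc L} {Φ : Set (B.Carrier × B.Carrier)}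
    (hΦ : Φ ∈ ConQ Q B) :
    ∃ D ∈ Q, ∃ g : B.Carrier →[L] D.Carrier, Function.Surjective g ∧ kerSet g = Φ := by
  obtain ⟨M, hM, f, rfl⟩ := hΦ
  refine ⟨ofSub M f.range, hQ.2.1 M hM f.range, f.codRestrict f.range fun a => ⟨a, rfl⟩, ?_, ?_⟩
  · rintro ⟨_, a, rfl⟩
    exact ⟨a, rfl⟩
  · ext ⟨a, b⟩
    exact Subtype.ext_iff

/-- A meet-irreducible `Q`-congruence that extends along `φ` has a meet-irreducible extension. -/
theorem exists_meetIrred_preimage_eq {L : FirstOrder.Language.{u, u}} [L.IsAlgebraic]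
    {Q : Set (Struc L)} (hQ : IsQuasivariety L Q) {A B : Struc L}
    (φ : A.Carrier →[L] B.Carrier) {θ : Set (A.Carrier × A.Carrier)} (hθ : MeetIrred Q A θ)
    (hext : ∃ Φ ∈ ConQ Q B, Prod.map φ φ ⁻¹' Φ = θ) :
    ∃ Φ, MeetIrred Q B Φ ∧ Prod.map φ φ ⁻¹' Φ = θ := by
  obtain ⟨Φ₀, hΦ₀⟩ := hext
  obtain ⟨Φ, -, hmax⟩ := zorn_subset_nonempty {Φ | Φ ∈ ConQ Q B ∧ Prod.map φ φ ⁻¹' Φ = θ}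
    (fun c hc hchain hne => ⟨⋃₀ c, ⟨sUnion_mem_ConQ hQ (fun Φ hΦ => (hc hΦ).1) hchain hne, by
      rw [Set.preimage_sUnion, Set.iUnion₂_congr fun Φ hΦ => (hc hΦ).2]
      exact Set.biUnion_const hne θ⟩, fun Φ => Set.subset_sUnion_of_mem⟩) Φ₀ hΦ₀
  refine ⟨Φ, ⟨hmax.prop.1, fun Φ₁ h₁ Φ₂ h₂ heq => ?_⟩, hmax.prop.2⟩
  refine (hθ.2 _ (preimage_mem_ConQ φ h₁) _ (preimage_mem_ConQ φ h₂) ?_).imp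
    (fun h => hmax.eq_of_subset ⟨h₁, h.symm⟩ (heq.trans_subset inter_subset_left))
    (fun h => hmax.eq_of_subset ⟨h₂, h.symm⟩ (heq.trans_subset inter_subset_right))
  rw [← Set.preimage_inter, ← heq, hmax.prop.2]

/-- Corollary 2.9: if `Q_RFSI` has the `Q`-CEP, then `Q_RFSI` has the EP. -/
theorem stmt8 (L : FirstOrder.Language.{u, u}) [L.IsAlgebraic]
    (Q : Set (Struc L)) (hQ : IsQuasivariety L Q)
    (h : ClassQCEP Q (RFSI Q)) :
    HasEP (RFSI Q) := by
  intro A _ B hB C hC φB φC hφB hφC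
  have hker : MeetIrred Q A (kerSet φC) := (meetIrred_kerSet_iff hφC hC.1).2 hC
  obtain ⟨Φ, hΦ, hres⟩ := exists_meetIrred_preimage_eq hQ φB hker
    ((h B hB).exists_preimage_eq hφB hker.1)
  obtain ⟨D, hD, g, hg, rfl⟩ := exists_surjective_kerSet_eq hQ hΦ.1
  obtain ⟨k, hk⟩ := exists_hom_factor φC (g.comp φB) hφC hres.superset
  refine ⟨D, (meetIrred_kerSet_iff hg hD).1 hΦ, g, k, fun x y hxy => ?_, fun a => (hk a).symm⟩
  obtain ⟨a, rfl⟩ := hφC x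
  obtain ⟨b, rfl⟩ := hφC y
  rw [hk, hk] at hxy
  exact (Set.ext_iff.1 hres (a, b)).1 hxy

end Transfer
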